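/- For every A > 0 and c₀ ∈ (0,1) there exists a constant A′, depending only on A and c₀, such that the following holds. Let E ⊂ ℝ² be finite, f : E → [0,∞), M ≥ 0. Let Q ⊂ ℝ² be a square of sidelength δ_Q, and let x_Q♯ ∈ Q satisfy dist(x_Q♯, E) ≥ c₀·δ_Q. Suppose Γ♯₊(x_Q♯, 16, M, f) ≠ ∅ and f(x) ≤ A·M·δ_Q² for some x ∈ E ∩ 5Q. Then the zero polynomial belongs to Γ♯₊(x_Q♯, 16, A′·M, f). -/

import Mathlib

/-- The plane `ℝ²`. -/
abbrev E2 := EuclideanSpace ℝ (Fin 2)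

/-- An affine polynomial on `ℝ²`, represented by its constant term and linear
part: `P(y) = P.1 + P.2 y`. -/
abbrev AffPoly := ℝ × (E2 →L[ℝ] ℝ)

/-- The one-jet `J_z F` of `F` at `z`, as an affine polynomial. -/
noncomputable def jet1 (F : E2 → ℝ) (z : E2) : AffPoly :=
  (F z - fderiv ℝ F z z, fderiv ℝ F z)

/-- `Γ₊(z,S,M,f)`: one-jets at `z` of nonnegative `C²` functions agreeing with
`f` on `S` and with `C²` norm at most `M`. -/
def gammaPlus (f : E2 → ℝ) (z : E2) (S : Set E2) (M : ℝ) : Set AffPoly :=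
  {p | ∃ F : E2 → ℝ, ContDiff ℝ 2 F ∧ (∀ y, 0 ≤ F y) ∧ (∀ y ∈ S, F y = f y) ∧
    (∀ w : E2, ∀ i : ℕ, i ≤ 2 → ‖iteratedFDeriv ℝ i F w‖ ≤ M) ∧ p = jet1 F z}

/-- `Γ♯₊(z,k,M,f) = ⋂_{S ⊆ E, #S ≤ k} Γ₊(z,S,M,f)`. -/
def gammaSharp (E : Set E2) (f : E2 → ℝ) (z : E2) (k : ℕ) (M : ℝ) :
    Set AffPoly :=
  ⋂ (S : Set E2) (_ : S ⊆ E ∧ S.ncard ≤ k), gammaPlus f z S M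

/-- Membership in the square `Q` with lower-left corner `a` and sidelength `δ`. -/
def inQ (a : E2) (δ : ℝ) (z : E2) : Prop :=
  ∀ i : Fin 2, a i ≤ z i ∧ z i < a i + δ

/-- Membership in the concentric square `5Q` of sidelength `5δ`. -/
def in5Q (a : E2) (δ : ℝ) (z : E2) : Prop :=
  ∀ i : Fin 2, a i - 2 * δ ≤ z i ∧ z i < a i + 3 * δ

section Calculus

variable {V : Type*} [NormedAddCommGroup V] [NormedSpace ℝ V]

/-- Rescaled cutoffs vanishing near `z` and equal to `1` outside the ball of radius `r`. -/
theorem exists_cutoff (V : Type*) [NormedAddCommGroup V] [NormedSpace ℝ V]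
    [FiniteDimensional ℝ V] :
    ∃ B : ℝ, 1 ≤ B ∧ ∀ (z : V) (r : ℝ), 0 < r → ∃ g : V → ℝ,
      ContDiff ℝ 2 g ∧ (∀ y, 0 ≤ g y) ∧ (∀ y, r ≤ dist y z → g y = 1) ∧
      (∀ᶠ y in nhds z, g y = 0) ∧
      ∀ i : ℕ, i ≤ 2 → ∀ w, ‖iteratedFDeriv ℝ i g w‖ ≤ B / r ^ i := by
  let χ : ContDiffBump (0 : V) := ⟨1 / 2, 1, by norm_num, by norm_num⟩
  have hχ : ContDiff ℝ 2 χ := χ.contDiff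
  have hbound (i : ℕ) (hi : i ≤ 2) :
      ∃ C, ∀ w, ‖iteratedFDeriv ℝ i (fun y ↦ 1 - χ y) w‖ ≤ C := by
    obtain ⟨C, hC⟩ := (χ.hasCompactSupport.iteratedFDeriv (𝕜 := ℝ) i).exists_bound_of_continuous
      (hχ.continuous_iteratedFDeriv (by exact_mod_cast hi))
    refine ⟨1 + C, fun w ↦ ?_⟩
    have hi' : (i : WithTop ℕ∞) ≤ 2 := by exact_mod_cast hi
    have hsub := fun_iteratedFDeriv_sub_apply (𝕜 := ℝ) (x := w) (i := i)
      (f := fun _ : V ↦ (1 : ℝ)) (g := χ) contDiffAt_const (hχ.of_le hi').contDiffAt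
    rw [hsub]
    refine (norm_sub_le _ _).trans (add_le_add ?_ (hC w))
    rcases Nat.eq_zero_or_pos i with rfl | hpos
    · simp
    · rw [iteratedFDeriv_const_of_ne hpos.ne']
      simp
  choose! C hC using hbound
  refine ⟨max 1 (max (C 0) (max (C 1) (C 2))), le_max_left _ _, fun z r hr ↦ ?_⟩
  have hψ : ContDiff ℝ 2 (fun y ↦ 1 - χ y) := contDiff_const.sub hχ
  have hnorm (y : V) : dist (r⁻¹ • (y - z)) 0 = r⁻¹ * dist y z := by
    rw [dist_zero_right, norm_smul, Real.norm_of_nonneg (by positivity), dist_eq_norm]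
  refine ⟨fun y ↦ 1 - χ (r⁻¹ • (y - z)), ?_, fun y ↦ sub_nonneg.2 χ.le_one, fun y hy ↦ ?_,
    ?_, fun i hi w ↦ ?_⟩
  · exact hψ.comp (contDiff_const.smul (contDiff_id.sub contDiff_const))
  · have : χ (r⁻¹ • (y - z)) = 0 := by
      apply χ.zero_of_le_dist
      rw [hnorm]
      calc (1 : ℝ) = r⁻¹ * r := by field_simp
        _ ≤ _ := by gcongr
    simp [this]
  · filter_upwards [Metric.closedBall_mem_nhds z (half_pos hr)] with y hy
    have : χ (r⁻¹ • (y - z)) = 1 := by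
      apply χ.one_of_mem_closedBall
      rw [Metric.mem_closedBall, hnorm]
      calc r⁻¹ * dist y z ≤ r⁻¹ * (r / 2) := by
            gcongr
            exact hy
        _ = 1 / 2 := by field_simp
    simp [this]
  · have hi' : (i : WithTop ℕ∞) ≤ 2 := by exact_mod_cast hi
    have h1 := iteratedFDeriv_comp_sub (𝕜 := ℝ) (f := fun y ↦ 1 - χ (r⁻¹ • y)) i z w
    have h2 := congrFun (iteratedFDeriv_comp_const_smul (𝕜 := ℝ) (f := fun y ↦ 1 - χ y) r⁻¹
      (hψ.of_le hi')) (w - z)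
    rw [h1, h2, norm_smul, norm_pow, Real.norm_of_nonneg (by positivity), inv_pow,
      inv_mul_eq_div]
    gcongr
    refine (hC i hi _).trans ?_
    interval_cases i <;> simp

variable {F : V → ℝ} {M : ℝ}

theorem norm_fderiv_sub_le_of_iteratedFDeriv_two (hF : ContDiff ℝ 2 F)
    (hM : ∀ w, ‖iteratedFDeriv ℝ 2 F w‖ ≤ M) (y z : V) :
    ‖fderiv ℝ F y - fderiv ℝ F z‖ ≤ M * ‖y - z‖ := by
  have hd : Differentiable ℝ (fderiv ℝ F) :=
    (hF.fderiv_right (m := 1) (by norm_num)).differentiable (by norm_num)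
  refine convex_univ.norm_image_sub_le_of_norm_fderiv_le (fun x _ ↦ hd x) (fun x _ ↦ ?_)
    (Set.mem_univ z) (Set.mem_univ y)
  rw [← norm_iteratedFDeriv_one, norm_iteratedFDeriv_fderiv]
  exact hM x

theorem abs_sub_taylor_one_le (hF : ContDiff ℝ 2 F)
    (hM : ∀ w, ‖iteratedFDeriv ℝ 2 F w‖ ≤ M) (y z : V) :
    |F y - F z - fderiv ℝ F z (y - z)| ≤ M * ‖y - z‖ ^ 2 := by
  have hM0 : 0 ≤ M := (norm_nonneg _).trans (hM z)
  have h := (convex_closedBall z ‖y - z‖).norm_image_sub_le_of_norm_fderiv_le'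
    (f := F) (φ := fderiv ℝ F z) (C := M * ‖y - z‖) (x := z) (y := y)
    (fun x _ ↦ (hF.differentiable (by norm_num)) x) (fun x hx ↦ ?_) (by simp)
    (by simp [dist_eq_norm])
  · rw [Real.norm_eq_abs] at h
    linarith
  · refine (norm_fderiv_sub_le_of_iteratedFDeriv_two hF hM x z).trans ?_
    rw [Metric.mem_closedBall, dist_eq_norm] at hx
    gcongr

/-- A nonnegative function with bounded second derivative has small gradient where it is small. -/
theorem norm_fderiv_le_of_nonneg {δ K : ℝ} (hF : ContDiff ℝ 2 F) (h0 : ∀ y, 0 ≤ F y)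
    (hM : ∀ w, ‖iteratedFDeriv ℝ 2 F w‖ ≤ M) (hδ : 0 < δ) (x : V)
    (hx : F x ≤ K * M * δ ^ 2) : ‖fderiv ℝ F x‖ ≤ (K + 1) * M * δ := by
  have hlow (v : V) (hv : ‖v‖ = 1) : - fderiv ℝ F x v ≤ (K + 1) * M * δ := by
    have h := (abs_le.1 (abs_sub_taylor_one_le hF hM (x + δ • v) x)).2
    have h' := h0 (x + δ • v)
    simp only [add_sub_cancel_left, map_smul, smul_eq_mul, norm_smul, hv,
      Real.norm_of_nonneg hδ.le, mul_one] at h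
    have : δ * (- fderiv ℝ F x v) ≤ δ * ((K + 1) * M * δ) := by nlinarith
    exact le_of_mul_le_mul_left this hδ
  have hM0 : 0 ≤ M := (norm_nonneg _).trans (hM x)
  have hC : 0 ≤ (K + 1) * M * δ := by
    have : 0 ≤ δ * ((K + 1) * M * δ) := by nlinarith [h0 x, mul_nonneg hM0 (sq_nonneg δ)]
    exact nonneg_of_mul_nonneg_right this hδ
  refine ContinuousLinearMap.opNorm_le_of_unit_norm hC fun v hv ↦ ?_
  rw [Real.norm_eq_abs, abs_le]
  have h1 := hlow v hv
  have h2 := hlow (-v) (by simpa using hv)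
  rw [map_neg] at h2
  constructor <;> linarith

/-- Smallness of value and gradient propagates over distances comparable to `δ`. -/
theorem small_of_small {δ K K' D : ℝ} (hF : ContDiff ℝ 2 F)
    (hM : ∀ w, ‖iteratedFDeriv ℝ 2 F w‖ ≤ M) {x y : V}
    (hx : F x ≤ K * M * δ ^ 2) (hx' : ‖fderiv ℝ F x‖ ≤ K' * M * δ)
    (hxy : ‖y - x‖ ≤ D * δ) :
    F y ≤ (K + K' * D + D ^ 2) * M * δ ^ 2 ∧ ‖fderiv ℝ F y‖ ≤ (K' + D) * M * δ := by
  have hM0 : 0 ≤ M := (norm_nonneg _).trans (hM x)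
  constructor
  · have h1 := (abs_le.1 (abs_sub_taylor_one_le hF hM y x)).2
    have h2 : fderiv ℝ F x (y - x) ≤ (K' * M * δ) * (D * δ) :=
      (le_abs_self _).trans (((fderiv ℝ F x).le_opNorm _).trans
        (mul_le_mul hx' hxy (norm_nonneg _) ((norm_nonneg _).trans hx')))
    have h3 : M * ‖y - x‖ ^ 2 ≤ M * (D * δ) ^ 2 := by gcongr
    nlinarith
  · have h1 := norm_fderiv_sub_le_of_iteratedFDeriv_two hF hM y x
    have h2 : M * ‖y - x‖ ≤ M * (D * δ) := by gcongr
    have h3 := norm_le_insert' (fderiv ℝ F y) (fderiv ℝ F x)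
    nlinarith

theorem norm_iteratedFDeriv_mul_le_of_bounds {g : V → ℝ} {δ K L : ℝ} {w : V}
    (hF : ContDiff ℝ 2 F) (hg : ContDiff ℝ 2 g) (hδ : 0 < δ) (hM : 0 ≤ M) (hK : 1 ≤ K)
    (hL : 0 ≤ L) (hFM : ∀ i : ℕ, i ≤ 2 → ‖iteratedFDeriv ℝ i F w‖ ≤ M)
    (h0 : ‖F w‖ ≤ K * M * δ ^ 2) (h1 : ‖fderiv ℝ F w‖ ≤ K * M * δ)
    (hgL : ∀ i : ℕ, i ≤ 2 → ‖iteratedFDeriv ℝ i g w‖ ≤ L / δ ^ i) (i : ℕ) (hi : i ≤ 2) :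
    ‖iteratedFDeriv ℝ i (fun y ↦ F y * g y) w‖ ≤ 4 * K * L * M := by
  have hi' : (i : WithTop ℕ∞) ≤ 2 := by exact_mod_cast hi
  refine (norm_iteratedFDeriv_mul_le hF hg w hi').trans ?_
  have hF0 := hFM 0 (by norm_num)
  have hF1 := hFM 1 (by norm_num)
  have hF2 := hFM 2 le_rfl
  have hg0 := hgL 0 (by norm_num)
  have hg1 := hgL 1 (by norm_num)
  have hg2 := hgL 2 le_rfl
  have hLM : 0 ≤ L * M := mul_nonneg hL hM
  have hKLM : L * M ≤ K * (L * M) := le_mul_of_one_le_left hLM hK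
  rw [← norm_iteratedFDeriv_one] at h1
  rw [← norm_iteratedFDeriv_zero (𝕜 := ℝ)] at h0
  rw [pow_zero, div_one] at hg0
  rw [pow_one] at hg1
  have h0' : ‖iteratedFDeriv ℝ 0 F w‖ ≤ K * M * δ := by
    rcases le_total δ 1 with h | h
    · refine h0.trans ?_
      gcongr
      nlinarith
    · refine hF0.trans ?_
      nlinarith [mul_nonneg (sub_nonneg.2 hK) hM,
        mul_nonneg (mul_nonneg (zero_le_one.trans hK) hM) (sub_nonneg.2 h)]
  have e1 : K * M * δ * (L / δ) = K * (L * M) := by field_simp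
  have e2 : K * M * δ ^ 2 * (L / δ ^ 2) = K * (L * M) := by field_simp
  have p00 := mul_le_mul hF0 hg0 (norm_nonneg _) hM
  have p10 := mul_le_mul hF1 hg0 (norm_nonneg _) hM
  have p20 := mul_le_mul hF2 hg0 (norm_nonneg _) hM
  have p01 := (mul_le_mul h0' hg1 (norm_nonneg _) (by positivity)).trans_eq e1
  have p11 := (mul_le_mul h1 hg1 (norm_nonneg _) (by positivity)).trans_eq e1
  have p02 := (mul_le_mul h0 hg2 (norm_nonneg _) (by positivity)).trans_eq e2
  interval_cases i
  · simp only [zero_add, Finset.sum_range_one, Nat.choose_self, Nat.cast_one, one_mul]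
    linarith
  · simp only [Nat.reduceAdd, Finset.sum_range_succ, Finset.sum_range_zero, zero_add,
      Nat.choose_zero_right, Nat.choose_self, Nat.cast_one, one_mul, Nat.sub_zero]
    linarith
  · simp only [Nat.reduceAdd, Finset.sum_range_succ, Finset.sum_range_zero, zero_add,
      Nat.choose_zero_right, Nat.choose_self, Nat.choose_one_right, Nat.cast_one, one_mul,
      Nat.sub_zero, Nat.reduceSub, Nat.cast_ofNat, mul_assoc]
    linarith

end Calculus

theorem jet1_eq_iff {F G : E2 → ℝ} {z : E2} :
    jet1 F z = jet1 G z ↔ F z = G z ∧ fderiv ℝ F z = fderiv ℝ G z := by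
  simp only [jet1, Prod.mk.injEq]
  constructor
  · rintro ⟨h1, h2⟩
    rw [h2] at h1
    exact ⟨sub_left_injective h1, h2⟩
  · rintro ⟨h1, h2⟩
    rw [h1, h2]
    exact ⟨rfl, rfl⟩

theorem norm_sub_le_of_inQ_of_in5Q {a x z : E2} {δ : ℝ} (hδ : 0 < δ) (hz : inQ a δ z)
    (hx : in5Q a δ x) : ‖z - x‖ ≤ 6 * δ := by
  rw [EuclideanSpace.norm_eq, Real.sqrt_le_left (by positivity), Fin.sum_univ_two]
  have h (i : Fin 2) : ‖(z - x) i‖ ^ 2 ≤ (3 * δ) ^ 2 := by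
    rw [Real.norm_eq_abs]
    gcongr
    rw [PiLp.sub_apply, abs_le]
    constructor <;> linarith [(hz i).1, (hz i).2, (hx i).1, (hx i).2]
  nlinarith [h 0, h 1]


/-- If `f` is small (≤ `A·M·δ_Q²`) somewhere on `E ∩ 5Q`,
then the zero jet belongs to `Γ♯₊(x_Q♯,16,A′·M,f)`. -/
theorem statement15 :
    ∀ A : ℝ, 0 < A → ∀ c₀ : ℝ, 0 < c₀ → c₀ < 1 →
      ∃ A' : ℝ, 0 < A' ∧
        ∀ E : Set E2, E.Finite → ∀ f : E2 → ℝ, (∀ x ∈ E, 0 ≤ f x) →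
          ∀ M : ℝ, 0 ≤ M →
          ∀ (a : E2) (δ : ℝ), 0 < δ →
          ∀ xs : E2, inQ a δ xs → (∀ y ∈ E, c₀ * δ ≤ dist xs y) →
          (gammaSharp E f xs 16 M).Nonempty →
          (∃ x ∈ E, in5Q a δ x ∧ f x ≤ A * M * δ ^ 2) →
          ((0 : ℝ), (0 : E2 →L[ℝ] ℝ)) ∈ gammaSharp E f xs 16 (A' * M) := by
  intro A hA c₀ hc₀ hc₁
  obtain ⟨B, hB, hcut⟩ := exists_cutoff E2
  set K : ℝ := 8 * A + 50 with hK
  set L : ℝ := B / c₀ ^ 2 with hL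
  have hBL : B ≤ L := le_div_self (by linarith) (by positivity) (pow_le_one₀ hc₀.le hc₁.le)
  have hKL : 1 ≤ 4 * K * L := by nlinarith
  refine ⟨4 * K * L, by linarith, ?_⟩
  intro E _ f _ M hM a δ hδ xs hxs hdist ⟨p, hp⟩ ⟨x, hxE, hx5, hfx⟩
  simp only [gammaSharp, Set.mem_iInter] at hp ⊢
  intro S hS
  obtain ⟨G, hG, hG0, hGx, hGM, hpG⟩ := hp {x} ⟨by simpa using hxE, by simp⟩
  obtain ⟨F, hF, hF0, hFS, hFM, hpF⟩ := hp S hS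
  obtain ⟨hFG, hFG'⟩ := jet1_eq_iff.1 (hpF.symm.trans hpG)
  have hF2 (w : E2) := hFM w 2 le_rfl
  have hG2 (w : E2) := hGM w 2 le_rfl
  have hGfx : G x ≤ A * M * δ ^ 2 := (hGx x rfl).trans_le hfx
  obtain ⟨hGs, hGs'⟩ := small_of_small hG hG2 hGfx
    (norm_fderiv_le_of_nonneg hG hG0 hG2 hδ x hGfx) (norm_sub_le_of_inQ_of_in5Q hδ hxs hx5)
  rw [← hFG] at hGs
  rw [← hFG'] at hGs'
  obtain ⟨g, hg, hg0, hg1, hgz, hgB⟩ := hcut xs (c₀ * δ) (by positivity)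
  have hgL (w : E2) (i : ℕ) (hi : i ≤ 2) : ‖iteratedFDeriv ℝ i g w‖ ≤ L / δ ^ i := by
    refine (hgB i hi w).trans ?_
    rw [hL, div_div, mul_pow]
    have : c₀ ^ 2 ≤ c₀ ^ i := pow_le_pow_of_le_one hc₀.le hc₁.le hi
    gcongr
  have hzero : (fun y ↦ F y * g y) =ᶠ[nhds xs] fun _ ↦ 0 := by
    filter_upwards [hgz] with y hy
    simp [hy]
  refine ⟨fun y ↦ F y * g y, hF.mul hg, fun y ↦ mul_nonneg (hF0 y) (hg0 y), fun y hy ↦ ?_,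
    fun w i hi ↦ ?_, ?_⟩
  · simp only [hg1 y ((hdist y (hS.1 hy)).trans_eq (dist_comm _ _)), mul_one, hFS y hy]
  · rcases le_or_gt (dist w xs) (c₀ * δ) with hw | hw
    · have hw' : ‖w - xs‖ ≤ 1 * δ := by
        rw [← dist_eq_norm]
        exact hw.trans (by gcongr)
      obtain ⟨hFw, hFw'⟩ := small_of_small hF hF2 hGs hGs' hw'
      have hMδ : 0 ≤ M * δ := by positivity
      refine norm_iteratedFDeriv_mul_le_of_bounds hF hg hδ hM (by linarith) (by linarith)
        (hFM w) ?_ (hFw'.trans ?_) (hgL w) i hi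
      · rw [Real.norm_of_nonneg (hF0 w)]
        refine hFw.trans_eq ?_
        rw [hK]
        ring
      · gcongr
        rw [hK]
        linarith
    · have hone : (fun y ↦ F y * g y) =ᶠ[nhds w] F := by
        filter_upwards [(isOpen_lt continuous_const (continuous_id.dist continuous_const)).mem_nhds
          hw] with y hy
        simp [hg1 y (le_of_lt hy)]
      rw [(hone.iteratedFDeriv ℝ i).eq_of_nhds]
      exact (hFM w i hi).trans (le_mul_of_one_le_left hM hKL)
  · have h0 : F xs * g xs = 0 := hzero.eq_of_nhds
    simp [jet1, hzero.fderiv_eq, h0]
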